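/- There exists a function H : ℂ → ℂ analytic on U = { s ∈ ℂ : s ≠ 1, s ≠ 0, and s ≠ 1 − 2m for every integer m ≥ 1 }, with H(s) = Σ_{n=1}^∞ H_n n^{−s} for all Re(s) > 1, such that for every integer m ≥ 2, the function s ↦ H(s) − ζ(1 − 2m)/(s + 2m − 1) tends to (2m − 1)!·A_{2m} − ψ(2m)·ζ(1 − 2m) as s → 1 − 2m within U. Here ζ is the Riemann zeta function, ψ(s) = Γ′(s)/Γ(s) is the digamma function, and A_n = Σ_{k=1}^{n} (B(k)/(k!·k))·(B(n−k)/(n−k)!) with B(j) the Bernoulli numbers with B(1) = +1/2. -/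

import Mathlib

open Complex Filter Topology Finset

/-- The domain of analyticity of the continuation of the Euler sum `h(s) = Σ H_n n^{−s}`:
all `s` except `s = 1`, `s = 0` and the negative odd integers `s = 1 − 2m`, `m ≥ 1`. -/
def eulerSumDomain : Set ℂ :=
  {s : ℂ | s ≠ 1 ∧ s ≠ 0 ∧ ∀ m : ℕ, 1 ≤ m → s ≠ 1 - 2 * (m : ℂ)}

/-- The convolution `A_n = Σ_{k+j=n, k≥1, j≥0} (B(k)/(k!·k))·(B(j)/j!)` where `B` are the
Bernoulli numbers with the convention `B(1) = +1/2` (Mathlib's `bernoulli'`). -/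
noncomputable def convA (n : ℕ) : ℂ :=
  ∑ k ∈ Finset.Icc 1 n,
    ((bernoulli' k : ℚ) : ℂ) / ((Nat.factorial k : ℂ) * k) *
      (((bernoulli' (n - k) : ℚ) : ℂ) / (Nat.factorial (n - k) : ℂ))


namespace EulerSumAux

/-- Asymptotic power series expansion at `0+`. -/
def HasExp (f : ℝ → ℝ) (φ : PowerSeries ℝ) : Prop :=
  ∀ N : ℕ, (fun x => f x - (PowerSeries.trunc N φ).eval x) =O[𝓝[>] (0:ℝ)] (fun x => x ^ N)

lemma poly_isBigO {N : ℕ} (p : Polynomial ℝ) (h : ∀ i < N, p.coeff i = 0) :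
    (fun x => p.eval x) =O[𝓝[>] (0:ℝ)] (fun x => x ^ N) := by
  obtain ⟨q, rfl⟩ := (Polynomial.X_pow_dvd_iff).2 h
  have h1 : (fun x => q.eval x) =O[𝓝[>] (0:ℝ)] (fun _ => (1:ℝ)) :=
    ((q.continuous.tendsto 0).mono_left nhdsWithin_le_nhds).isBigO_one ℝ
  have := (Asymptotics.isBigO_refl (fun x : ℝ => x ^ N) (𝓝[>] (0:ℝ))).mul h1
  simpa using this

lemma hasExp_of_poly {f : ℝ → ℝ} {φ : PowerSeries ℝ}
    (h : ∀ N : ℕ, ∃ p : Polynomial ℝ, (∀ i < N, p.coeff i = PowerSeries.coeff i φ) ∧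
      (fun x => f x - p.eval x) =O[𝓝[>] (0:ℝ)] (fun x => x ^ N)) : HasExp f φ := by
  intro N
  obtain ⟨p, hp, hO⟩ := h N
  have := hO.add (poly_isBigO (N := N) (p - PowerSeries.trunc N φ) (by
    intro i hi
    simp [PowerSeries.coeff_trunc, hi, hp i hi]))
  refine this.congr_left fun x => ?_
  simp

lemma HasExp.bdd {f : ℝ → ℝ} {φ : PowerSeries ℝ} (h : HasExp f φ) :
    f =O[𝓝[>] (0:ℝ)] (fun _ => (1:ℝ)) := by
  simpa using h 0

lemma HasExp.congr {f g : ℝ → ℝ} {φ : PowerSeries ℝ} (h : HasExp f φ)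
    (hfg : ∀ x, 0 < x → f x = g x) : HasExp g φ := by
  intro N
  refine (h N).congr' ?_ .rfl
  filter_upwards [self_mem_nhdsWithin] with x hx
  rw [hfg x hx]

lemma HasExp.mul {f g : ℝ → ℝ} {φ ψ : PowerSeries ℝ} (hf : HasExp f φ) (hg : HasExp g ψ) :
    HasExp (fun x => f x * g x) (φ * ψ) := by
  refine hasExp_of_poly fun N => ⟨PowerSeries.trunc N φ * PowerSeries.trunc N ψ, ?_, ?_⟩
  · intro i hi
    rw [PowerSeries.coeff_mul_eq_coeff_trunc_mul_trunc _ _ hi, ← Polynomial.coe_mul, Polynomial.coeff_coe]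
  · have hp : (fun x => (PowerSeries.trunc N φ).eval x) =O[𝓝[>] (0:ℝ)] (fun _ => (1:ℝ)) :=
      (((PowerSeries.trunc N φ).continuous.tendsto 0).mono_left nhdsWithin_le_nhds).isBigO_one ℝ
    have h1 := (hf N).mul hg.bdd
    have h2 := hp.mul (hg N)
    simp only [mul_one, one_mul] at h1 h2
    refine (h1.add h2).congr_left fun x => ?_
    simp only [Polynomial.eval_mul]
    ring

lemma hasExp_poly (p : Polynomial ℝ) : HasExp (fun x => p.eval x) (p : PowerSeries ℝ) :=
  hasExp_of_poly fun N => ⟨p, by simp, by simpa using Asymptotics.isBigO_zero _ _⟩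

lemma HasExp.inv {g v : ℝ → ℝ} {φ u : PowerSeries ℝ} (hv : HasExp v u) (hu : φ * u = 1)
    (hg : g =O[𝓝[>] (0:ℝ)] (fun _ => (1:ℝ))) (hgv : ∀ x, 0 < x → g x * v x = 1) :
    HasExp g φ := by
  intro N
  have h1 := ((hasExp_poly (PowerSeries.trunc N φ)).mul hv) N
  have h2 := hg.mul h1.neg_left
  have h3 : (fun x => g x * (PowerSeries.trunc N
      (((PowerSeries.trunc N φ : Polynomial ℝ) : PowerSeries ℝ) * u - 1)).eval x) =O[𝓝[>] (0:ℝ)] (fun x => x ^ N) := by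
    have : PowerSeries.trunc N (((PowerSeries.trunc N φ : Polynomial ℝ) : PowerSeries ℝ) * u - 1) = 0 := by
      rw [PowerSeries.trunc_sub, PowerSeries.trunc_trunc_mul, hu, sub_self]
    simpa [this] using Asymptotics.isBigO_zero _ _
  have h4 : (fun x => g x * (1 - (PowerSeries.trunc N (1:PowerSeries ℝ)).eval x))
      =O[𝓝[>] (0:ℝ)] (fun x => x ^ N) := by
    have := (hasExp_poly (1 : Polynomial ℝ)) N
    simp only [Polynomial.eval_one, Polynomial.coe_one] at this
    simpa using hg.mul this
  simp only [one_mul] at h2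
  refine ((h2.sub h3).add h4).congr' ?_ .rfl
  filter_upwards [self_mem_nhdsWithin] with x hx
  have := hgv x hx
  rw [PowerSeries.trunc_sub, Polynomial.eval_sub]
  linear_combination -(PowerSeries.trunc N φ).eval x * this

lemma trunc_eval (N : ℕ) (φ : PowerSeries ℝ) (x : ℝ) :
    (PowerSeries.trunc N φ).eval x = ∑ i ∈ range N, PowerSeries.coeff i φ * x ^ i := by
  have := PowerSeries.eval₂_trunc_eq_sum_range x (RingHom.id ℝ) N φ
  simpa [Polynomial.eval₂_id] using this

lemma hasExp_exp : HasExp Real.exp (PowerSeries.exp ℝ) := by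
  intro N
  refine ((Real.exp_sub_sum_range_isBigO_pow N).mono nhdsWithin_le_nhds).congr_left fun x => ?_
  rw [trunc_eval]
  congr 1
  refine Finset.sum_congr rfl fun i _ => ?_
  simp [PowerSeries.coeff_exp, div_eq_inv_mul]

/-- series of `(exp x - 1)/x` -/
noncomputable def uSer : PowerSeries ℝ := PowerSeries.mk fun n => ((n + 1).factorial : ℝ)⁻¹

lemma X_mul_uSer : PowerSeries.X * uSer = PowerSeries.exp ℝ - 1 := by
  ext n
  cases n with
  | zero => simp
  | succ n => simp [PowerSeries.coeff_succ_X_mul, uSer, PowerSeries.coeff_exp, PowerSeries.coeff_one]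

lemma hasExp_u : HasExp (fun x => (Real.exp x - 1) / x) uSer := by
  intro N
  have h := hasExp_exp (N + 1)
  have h2 := h.mul (Asymptotics.isBigO_refl (fun x : ℝ => x⁻¹) (𝓝[>] (0:ℝ)))
  refine h2.congr' ?_ ?_
  · filter_upwards [self_mem_nhdsWithin] with x hx
    have hx' : x ≠ 0 := ne_of_gt hx
    rw [trunc_eval, trunc_eval, Finset.sum_range_succ']
    simp only [PowerSeries.coeff_exp, uSer, PowerSeries.coeff_mk]
    have : ∑ i ∈ range N, (algebraMap ℚ ℝ) (1 / ((i+1).factorial : ℚ)) * x ^ (i+1)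
        = x * ∑ i ∈ range N, ((i + 1).factorial : ℝ)⁻¹ * x ^ i := by
      rw [Finset.mul_sum]
      refine Finset.sum_congr rfl fun i _ => ?_
      simp; ring
    rw [this]
    simp
    field_simp
    ring
  · filter_upwards [self_mem_nhdsWithin] with x hx
    have hx' : x ≠ 0 := ne_of_gt hx
    field_simp
    ring

lemma exp_sub_one_pos {x : ℝ} (hx : 0 < x) : 0 < Real.exp x - 1 := by
  have := Real.add_one_lt_exp hx.ne'
  linarith

/-- `x/(e^x-1)` -/
noncomputable def Pm (x : ℝ) : ℝ := x / (Real.exp x - 1)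

lemma hasExp_Pm : HasExp Pm (bernoulliPowerSeries ℝ) := by
  refine hasExp_u.inv ?_ ?_ ?_
  · have h := bernoulliPowerSeries_mul_exp_sub_one ℝ
    rw [← X_mul_uSer] at h
    refine mul_left_cancel₀ (PowerSeries.X_ne_zero (R := ℝ)) ?_
    rw [mul_one]; linear_combination h
  · refine Asymptotics.IsBigO.of_bound 1 ?_
    filter_upwards [self_mem_nhdsWithin] with x hx
    have h1 := exp_sub_one_pos hx
    have h2 := Real.add_one_lt_exp (ne_of_gt hx)
    rw [Pm, norm_one, mul_one, Real.norm_eq_abs, abs_of_nonneg (div_nonneg (le_of_lt hx) h1.le), div_le_one h1]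
    linarith
  · intro x hx
    have h1 := (exp_sub_one_pos hx).ne'
    rw [Pm]
    field_simp

/-- `x/(1-e^{-x})` -/
noncomputable def Pp (x : ℝ) : ℝ := x / (1 - Real.exp (-x))

lemma one_sub_exp_pos {x : ℝ} (hx : 0 < x) : 0 < 1 - Real.exp (-x) := by
  have : Real.exp (-x) < 1 := by rw [Real.exp_lt_one_iff]; linarith
  linarith

lemma Pm_eq {x : ℝ} (hx : 0 < x) : Pm x * Real.exp x = Pp x := by
  have h1 := (exp_sub_one_pos hx).ne'
  have h2 := (one_sub_exp_pos hx).ne'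
  rw [Pm, Pp, div_mul_eq_mul_div, div_eq_div_iff h1 h2, Real.exp_neg]
  have := (Real.exp_pos x).ne'
  field_simp

lemma hasExp_Pp : HasExp Pp (bernoulli'PowerSeries ℝ) := by
  have h := (hasExp_Pm.mul hasExp_exp).congr (g := Pp) (fun x hx => Pm_eq hx)
  have e : bernoulliPowerSeries ℝ * PowerSeries.exp ℝ = bernoulli'PowerSeries ℝ := by
    have h0 : PowerSeries.exp ℝ - 1 ≠ 0 := by
      intro h0
      have := bernoulliPowerSeries_mul_exp_sub_one ℝ
      rw [h0, mul_zero] at this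
      exact PowerSeries.X_ne_zero this.symm
    refine mul_right_cancel₀ h0 ?_
    rw [bernoulli'PowerSeries_mul_exp_sub_one]
    linear_combination PowerSeries.exp ℝ * bernoulliPowerSeries_mul_exp_sub_one ℝ
  rwa [e] at h

/-- `log((1-e^{-x})/x)` -/
noncomputable def Lf (x : ℝ) : ℝ := Real.log ((1 - Real.exp (-x)) / x)

noncomputable def lSer : PowerSeries ℝ :=
  PowerSeries.mk fun n => ((bernoulli n : ℚ) : ℝ) / (n.factorial * n)

lemma Lf_deriv {x : ℝ} (hx : 0 < x) : HasDerivAt Lf ((Pm x - 1) / x) x := by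
  have h2 := (one_sub_exp_pos hx).ne'
  have h1 := (exp_sub_one_pos hx).ne'
  have hd : HasDerivAt (fun y : ℝ => (1 - Real.exp (-y)) / y)
      ((Real.exp (-x) * x - (1 - Real.exp (-x)) * 1) / x ^ 2) x := by
    have a : HasDerivAt (fun y : ℝ => 1 - Real.exp (-y)) (Real.exp (-x)) x := by
      have := ((hasDerivAt_neg x).exp).const_sub 1
      simpa using this
    exact a.div (hasDerivAt_id x) hx.ne'
  have := hd.log (div_ne_zero h2 hx.ne')
  convert! this using 1
  rw [Pm]
  rw [Real.exp_neg] at h2 ⊢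
  have h3 := (Real.exp_pos x).ne'
  have h4 : (1 - (Real.exp x)⁻¹) = (Real.exp x - 1) / Real.exp x := by field_simp
  rw [h4]
  field_simp

lemma Lf_tendsto : Tendsto Lf (𝓝[>] 0) (𝓝 0) := by
  have h : Tendsto (fun x : ℝ => (1 - Real.exp (-x)) / x) (𝓝[>] 0) (𝓝 1) := by
    have a : HasDerivAt (fun y : ℝ => 1 - Real.exp (-y)) 1 0 := by
      have := ((hasDerivAt_neg (0:ℝ)).exp).const_sub 1
      simpa using this
    have := a.tendsto_slope_zero_right
    simpa [div_eq_inv_mul] using this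
  have := (Real.continuousAt_log one_ne_zero).tendsto.comp h
  simpa using! this

lemma isBigO_of_deriv {D D' : ℝ → ℝ} (N : ℕ) (hD : ∀ x, 0 < x → HasDerivAt D (D' x) x)
    (h0 : Tendsto D (𝓝[>] 0) (𝓝 0)) (hO : D' =O[𝓝[>] (0:ℝ)] (fun x => x ^ N)) :
    D =O[𝓝[>] (0:ℝ)] (fun x => x ^ (N + 1)) := by
  obtain ⟨C, hC, hb⟩ := hO.exists_pos
  have hb := hb.bound
  rw [eventually_nhdsWithin_iff, Metric.eventually_nhds_iff] at hb
  obtain ⟨δ, hδ, hb⟩ := hb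
  refine Asymptotics.IsBigO.of_bound C ?_
  have hlt : ∀ᶠ x in 𝓝[>] (0:ℝ), x < δ := by
    filter_upwards [Ioo_mem_nhdsGT hδ] with x hx using hx.2
  filter_upwards [self_mem_nhdsWithin, hlt] with x hx hxd
  have hx : 0 < x := hx
  have key : ∀ y ∈ Set.Ioo 0 x, ‖D x - D y‖ ≤ C * x ^ N * x := by
    intro y hy
    have := (convex_Icc y x).norm_image_sub_le_of_norm_hasDerivWithin_le (f := D) (f' := D')
      (C := C * x ^ N) (x := y) (y := x)
      (fun z hz => (hD z (hy.1.trans_le hz.1)).hasDerivWithinAt) (fun z hz => ?_)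
      ⟨le_rfl, hy.2.le⟩ ⟨hy.2.le, le_rfl⟩
    · refine this.trans ?_
      gcongr
      rw [Real.norm_eq_abs, abs_of_nonneg (by linarith [hy.2])]
      linarith [hy.1]
    · have hz0 : 0 < z := hy.1.trans_le hz.1
      have := hb (y := z) (by rw [Real.dist_eq, sub_zero, abs_of_pos hz0]; linarith [hz.2]) hz0
      refine this.trans ?_
      rw [norm_pow, Real.norm_eq_abs, abs_of_pos hz0]
      gcongr
      exact hz.2
  have ht : Tendsto (fun y => ‖D x - D y‖) (𝓝[>] 0) (𝓝 ‖D x - 0‖) := (h0.const_sub _).norm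
  have := le_of_tendsto ht (by
    filter_upwards [Ioo_mem_nhdsGT hx] with y hy using key y hy)
  rw [sub_zero] at this
  rw [norm_pow, Real.norm_eq_abs x, abs_of_pos hx, pow_succ, ← mul_assoc]
  exact this

lemma hasExp_Lf : HasExp Lf lSer := by
  intro N
  cases N with
  | zero => simpa using Lf_tendsto.isBigO_one ℝ
  | succ N =>
    refine isBigO_of_deriv (D' := fun x => (Pm x - 1) / x
      - (PowerSeries.trunc (N+1) lSer).derivative.eval x) N ?_ ?_ ?_
    · intro x hx
      exact (Lf_deriv hx).sub ((PowerSeries.trunc (N+1) lSer).hasDerivAt x)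
    · have h : Tendsto (fun x => (PowerSeries.trunc (N+1) lSer).eval x) (𝓝[>] (0:ℝ)) (𝓝 0) := by
        have := ((PowerSeries.trunc (N+1) lSer).continuous.tendsto 0).mono_left
          (nhdsWithin_le_nhds (s := Set.Ioi 0))
        have e : (PowerSeries.trunc (N+1) lSer).eval 0 = 0 := by
          rw [trunc_eval]
          refine Finset.sum_eq_zero fun i _ => ?_
          cases i <;> simp [lSer]
        rwa [e] at this
      simpa using Lf_tendsto.sub h
    · have h2 := (hasExp_Pm (N+1)).mul (Asymptotics.isBigO_refl (fun x : ℝ => x⁻¹) (𝓝[>] (0:ℝ)))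
      refine h2.congr' ?_ ?_
      · filter_upwards [self_mem_nhdsWithin] with x hx
        have hx' : x ≠ 0 := ne_of_gt hx
        have e : x * (PowerSeries.trunc (N+1) lSer).derivative.eval x
            = ∑ i ∈ range N, PowerSeries.coeff (i+1) (bernoulliPowerSeries ℝ) * x ^ (i+1) := by
          have h1 := (PowerSeries.trunc (N+1) lSer).hasDerivAt x
          have h2 : HasDerivAt (fun y : ℝ => (PowerSeries.trunc (N+1) lSer).eval y)
              (∑ i ∈ range (N+1), PowerSeries.coeff i lSer * (i * x ^ (i-1))) x := by
            simp_rw [trunc_eval]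
            refine HasDerivAt.fun_sum fun i _ => ?_
            exact (hasDerivAt_pow i x).const_mul _
          rw [h1.unique h2, Finset.sum_range_succ']
          simp only [Nat.cast_zero, zero_mul, mul_zero, add_zero]
          rw [Finset.mul_sum]
          refine Finset.sum_congr rfl fun i _ => ?_
          simp only [lSer, bernoulliPowerSeries, PowerSeries.coeff_mk]
          have : ((i:ℝ)+1) ≠ 0 := by positivity
          simp
          field_simp
          ring
        rw [trunc_eval, Finset.sum_range_succ', ← e]
        simp [bernoulliPowerSeries]
        field_simp
        ring
      · filter_upwards [self_mem_nhdsWithin] with x hx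
        have hx' : x ≠ 0 := ne_of_gt hx
        field_simp
        ring

end EulerSumAux

namespace EulerSumAux

open MeasureTheory

/-- the generating function `∑ H_n e^{-nx}` -/
noncomputable def Fr (x : ℝ) : ℝ := -Real.log (1 - Real.exp (-x)) / (1 - Real.exp (-x))

noncomputable def bR (n : ℕ) : ℝ := PowerSeries.coeff n (bernoulli'PowerSeries ℝ)
noncomputable def aR (n : ℕ) : ℝ := PowerSeries.coeff n (lSer * bernoulli'PowerSeries ℝ)

noncomputable def gN (n : ℕ) : ℝ → ℂ := Set.indicator (Set.Ioc 0 1) (fun t : ℝ => (t:ℂ) ^ ((n:ℂ) - 1))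

noncomputable def fN (N : ℕ) (x : ℝ) : ℂ :=
  (Fr x : ℂ) + ∑ n ∈ range N, ((bR n : ℂ) * (Real.log x • gN n x) + (aR n : ℂ) * gN n x)

lemma Fr_eq {x : ℝ} (hx : 0 < x) : x * Fr x = - Real.log x * Pp x - Lf x * Pp x := by
  have h2 := (one_sub_exp_pos hx).ne'
  rw [Fr, Pp, Lf, Real.log_div h2 hx.ne']
  field_simp
  ring

lemma Fr_cont : ContinuousOn Fr (Set.Ioi 0) := by
  intro x hx
  have h2 := (one_sub_exp_pos hx).ne'
  have c : ContinuousAt (fun x : ℝ => 1 - Real.exp (-x)) x := by fun_prop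
  exact ((c.log h2).neg.div c h2).continuousWithinAt

lemma gN_eq {n : ℕ} {x : ℝ} (hx : x ∈ Set.Ioc (0:ℝ) 1) : gN n x = ((x ^ n / x : ℝ) : ℂ) := by
  have : (x:ℂ) ≠ 0 := by exact_mod_cast hx.1.ne'
  rw [gN, Set.indicator_of_mem hx, Complex.cpow_sub _ _ this, Complex.cpow_natCast, Complex.cpow_one]
  push_cast; rfl

lemma gN_eq_zero {n : ℕ} {x : ℝ} (hx : 1 < x) : gN n x = 0 := by
  rw [gN, Set.indicator_of_notMem]
  simp; intro _; exact hx

lemma gN_loc (n : ℕ) : LocallyIntegrableOn (gN n) (Set.Ioi 0) := by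
  have c : ContinuousOn (fun t : ℝ => (t:ℂ) ^ ((n:ℂ) - 1)) (Set.Ioi 0) := by
    intro x hx
    exact (Complex.continuousAt_ofReal_cpow_const _ _ (Or.inr (ne_of_gt hx))).continuousWithinAt
  have := c.locallyIntegrableOn (μ := volume) measurableSet_Ioi
  rw [locallyIntegrableOn_iff (by exact (isOpen_Ioi).isLocallyClosed)] at this ⊢
  intro k hk hkc
  exact (this k hk hkc).indicator measurableSet_Ioc

lemma gN_top (n : ℕ) (a : ℝ) : gN n =O[atTop] (fun x : ℝ => x ^ (-a)) := by
  refine (Asymptotics.isBigO_zero _ _).congr' ?_ .rfl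
  filter_upwards [eventually_gt_atTop 1] with x hx using (gN_eq_zero hx).symm

lemma gN_bot (n : ℕ) : gN n =O[𝓝[>] 0] (fun x : ℝ => x ^ (-(1 - n : ℝ))) := by
  refine Asymptotics.IsBigO.of_bound 1 ?_
  filter_upwards [Ioo_mem_nhdsGT (zero_lt_one' ℝ)] with x hx
  rw [gN_eq ⟨hx.1, hx.2.le⟩, Complex.norm_real, one_mul, neg_sub, Real.rpow_sub hx.1, Real.rpow_natCast,
    Real.rpow_one]

lemma gN_mellin (n : ℕ) {s : ℂ} (hs : 1 - (n:ℝ) < s.re) : HasMellin (gN n) s (1 / (s + n - 1)) := by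
  have := hasMellin_cpow_Ioc ((n:ℂ) - 1) (s := s) (by simp; linarith)
  rwa [← add_sub_assoc] at this

lemma re_pos_ne {n : ℕ} {s : ℂ} (hs : 1 - (n:ℝ) < s.re) : s + n - 1 ≠ 0 := by
  intro h
  have := congrArg Complex.re h
  simp at this
  linarith

lemma gNlog_mellin (n : ℕ) {s : ℂ} (hs : 1 - (n:ℝ) < s.re) :
    HasMellin (fun t => Real.log t • gN n t) s (-1 / (s + n - 1) ^ 2) := by
  obtain ⟨h1, h2⟩ := mellin_hasDerivAt_of_isBigO_rpow (gN_loc n) (gN_top n (s.re + 1)) (by linarith)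
    (gN_bot n) hs
  refine ⟨h1, ?_⟩
  have h3 : HasDerivAt (fun z : ℂ => 1 / (z + n - 1)) (-1 / (s + n - 1) ^ 2) s := by
    have := (((hasDerivAt_id s).add_const (n:ℂ)).sub_const 1).fun_inv (re_pos_ne hs)
    simpa [one_div] using this
  refine h2.unique (h3.congr_of_eventuallyEq ?_)
  have : ∀ᶠ z : ℂ in 𝓝 s, 1 - (n:ℝ) < z.re :=
    (isOpen_lt continuous_const Complex.continuous_re).mem_nhds hs
  filter_upwards [this] with z hz using (gN_mellin n hz).2

lemma gNlog_loc (n : ℕ) : LocallyIntegrableOn (fun t => Real.log t • gN n t) (Set.Ioi 0) := by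
  have c : ContinuousOn (fun t : ℝ => Real.log t • (t:ℂ) ^ ((n:ℂ) - 1)) (Set.Ioi 0) := by
    intro x hx
    exact ((Real.continuousAt_log (ne_of_gt hx)).smul (Complex.continuousAt_ofReal_cpow_const _ _ (Or.inr (ne_of_gt hx)))).continuousWithinAt
  have := c.locallyIntegrableOn (μ := volume) measurableSet_Ioi
  rw [locallyIntegrableOn_iff (by exact (isOpen_Ioi).isLocallyClosed)] at this ⊢
  intro k hk hkc
  have := (this k hk hkc).indicator (measurableSet_Ioc (a := (0:ℝ)) (b := 1))
  refine this.congr (Filter.Eventually.of_forall fun t => ?_)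
  by_cases ht : t ∈ Set.Ioc (0:ℝ) 1 <;> simp [gN, ht]

lemma fN_loc (N : ℕ) : LocallyIntegrableOn (fN N) (Set.Ioi 0) := by
  have h0 : LocallyIntegrableOn (fun x => (Fr x : ℂ)) (Set.Ioi 0) :=
    (Complex.continuous_ofReal.comp_continuousOn Fr_cont).locallyIntegrableOn measurableSet_Ioi
  induction N with
  | zero =>
    have : fN 0 = fun x => (Fr x : ℂ) := by funext x; simp [fN]
    rw [this]; exact h0
  | succ N ih =>
    have : fN (N+1) = fun x => fN N x + ((bR N : ℂ) • (Real.log x • gN N x) + (aR N : ℂ) • gN N x) := by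
      funext x
      simp only [fN, Finset.sum_range_succ, smul_eq_mul, add_assoc]
    rw [this]
    rw [locallyIntegrableOn_iff (by exact (isOpen_Ioi).isLocallyClosed)] at ih ⊢
    intro k hk hkc
    have h1 := gNlog_loc N
    have h2 := gN_loc N
    rw [locallyIntegrableOn_iff (by exact (isOpen_Ioi).isLocallyClosed)] at h1 h2
    exact (ih k hk hkc).add (((h1 k hk hkc).smul (bR N : ℂ)).add ((h2 k hk hkc).smul (aR N : ℂ)))

lemma fN_top (N : ℕ) (a : ℝ) : fN N =O[atTop] (fun x : ℝ => x ^ (-a)) := by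
  have h1 : fN N =O[atTop] (fun x : ℝ => Real.exp (-1 * x)) := by
    refine Asymptotics.IsBigO.of_bound 4 ?_
    filter_upwards [eventually_gt_atTop 1] with x hx
    have e : fN N x = (Fr x : ℂ) := by
      simp [fN, gN_eq_zero hx]
    have hy : Real.exp (-x) ≤ 1/2 := by
      have h2 : (2:ℝ) ≤ Real.exp x := by
        have := Real.add_one_le_exp x
        linarith
      rw [Real.exp_neg, one_div]
      exact inv_anti₀ (by norm_num) h2
    have hy0 := Real.exp_pos (-x)
    rw [e, Complex.norm_real, Fr, neg_one_mul, Real.norm_eq_abs, Real.norm_eq_abs, abs_of_pos hy0, abs_div,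
      abs_neg]
    set y := Real.exp (-x)
    have h3 : |Real.log (1 - y)| ≤ 2 * y := by
      rw [abs_of_nonpos (Real.log_nonpos (by linarith) (by linarith))]
      have := Real.one_sub_inv_le_log_of_pos (show 0 < 1 - y by linarith)
      have h4 : (1 - y)⁻¹ ≤ 1 + 2 * y := by
        rw [inv_le_iff_one_le_mul₀ (by linarith)]
        nlinarith
      linarith
    rw [abs_of_pos (show 0 < 1 - y by linarith), div_le_iff₀ (by linarith)]
    nlinarith
  refine h1.trans ?_
  exact (isLittleO_exp_neg_mul_rpow_atTop (by norm_num) (-a)).isBigO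

lemma fN_bot (N : ℕ) {b : ℝ} (hb : 1 - (N:ℝ) < b) : fN N =O[𝓝[>] 0] (fun x : ℝ => x ^ (-b)) := by
  set ε := b - (1 - (N:ℝ)) with hε
  have hε0 : 0 < ε := by linarith
  have hlog : Real.log =O[𝓝[>] 0] (fun x : ℝ => x ^ (-ε)) :=
    (isLittleO_log_rpow_nhdsGT_zero (by linarith)).isBigO
  have hone : (fun _ : ℝ => (1:ℝ)) =O[𝓝[>] 0] (fun x : ℝ => x ^ (-ε)) := by
    refine Asymptotics.IsBigO.of_bound 1 ?_
    filter_upwards [Ioo_mem_nhdsGT (zero_lt_one' ℝ)] with x hx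
    rw [one_mul, norm_one, Real.norm_eq_abs, abs_of_pos (Real.rpow_pos_of_pos hx.1 _)]
    exact Real.one_le_rpow_of_pos_of_le_one_of_nonpos hx.1 hx.2.le (by linarith)
  have hP := hasExp_Pp N
  have hLP := (hasExp_Lf.mul hasExp_Pp) N
  have h1 := hlog.mul hP
  have h2 := hone.mul hLP
  have h3 := ((h1.add h2).neg_left).mul (Asymptotics.isBigO_refl (fun x : ℝ => x⁻¹) (𝓝[>] (0:ℝ)))
  have h4 := Complex.isBigO_ofReal_left.2 h3
  refine h4.congr' ?_ ?_
  · filter_upwards [Ioo_mem_nhdsGT (zero_lt_one' ℝ)] with x hx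
    have hx' : x ≠ 0 := hx.1.ne'
    have e : fN N x = ((Fr x + ∑ n ∈ range N, (bR n * (Real.log x * (x^n/x)) + aR n * (x^n/x)) : ℝ) : ℂ) := by
      rw [fN]
      push_cast
      congr 1
      refine Finset.sum_congr rfl fun n _ => ?_
      rw [gN_eq ⟨hx.1, hx.2.le⟩, Complex.real_smul]
      push_cast; rfl
    rw [e]
    congr 1
    have hF : Fr x = (- Real.log x * Pp x - Lf x * Pp x) * x⁻¹ := by
      rw [← Fr_eq hx.1]; field_simp
    rw [hF, trunc_eval, trunc_eval, Finset.sum_add_distrib]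
    have e1 : ∑ n ∈ range N, (bR n * (Real.log x * (x^n/x))) =
        Real.log x * (∑ i ∈ range N, PowerSeries.coeff i (bernoulli'PowerSeries ℝ) * x ^ i) * x⁻¹ := by
      rw [Finset.mul_sum, Finset.sum_mul]
      refine Finset.sum_congr rfl fun n _ => ?_
      rw [bR]; ring
    have e2 : ∑ n ∈ range N, (aR n * (x^n/x)) =
        (∑ i ∈ range N, PowerSeries.coeff i (lSer * bernoulli'PowerSeries ℝ) * x ^ i) * x⁻¹ := by
      rw [Finset.sum_mul]
      refine Finset.sum_congr rfl fun n _ => ?_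
      rw [aR]; ring
    rw [e1, e2]
    ring
  · filter_upwards [self_mem_nhdsWithin] with x hx
    have hx : 0 < x := hx
    rw [← Real.rpow_natCast, ← Real.rpow_neg_one x, ← Real.rpow_add hx, ← Real.rpow_add hx]
    congr 1
    rw [hε]; ring

lemma fN_conv (N : ℕ) {s : ℂ} (hs : 1 - (N:ℝ) < s.re) : MellinConvergent (fN N) s := by
  obtain ⟨b, hb1, hb2⟩ := exists_between hs
  exact mellinConvergent_of_isBigO_rpow (fN_loc N) (fN_top N (s.re + 1)) (by linarith) (fN_bot N hb1) hb2

lemma fN_diff (N : ℕ) {s : ℂ} (hs : 1 - (N:ℝ) < s.re) : DifferentiableAt ℂ (mellin (fN N)) s := by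
  obtain ⟨b, hb1, hb2⟩ := exists_between hs
  exact mellin_differentiableAt_of_isBigO_rpow (fN_loc N) (fN_top N (s.re + 1)) (by linarith) (fN_bot N hb1) hb2

lemma fN_succ (N : ℕ) {s : ℂ} (hs : 1 - (N:ℝ) < s.re) :
    mellin (fN N) s = mellin (fN (N+1)) s + bR N * (1 / (s + N - 1) ^ 2) - aR N * (1 / (s + N - 1)) := by
  have h1 := gNlog_mellin N hs
  have h2 := gN_mellin N hs
  have h3 := hasMellin_const_smul h1.1 (bR N : ℂ)
  have h4 := hasMellin_const_smul h2.1 (aR N : ℂ)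
  have h5 := hasMellin_add (fN_conv N hs) (hasMellin_add h3.1 h4.1).1
  have : fN (N+1) = fun x => fN N x + ((bR N : ℂ) • (Real.log x • gN N x) + (aR N : ℂ) • gN N x) := by
    funext x
    simp only [fN, Finset.sum_range_succ, smul_eq_mul, add_assoc]
  rw [this, h5.2, (hasMellin_add h3.1 h4.1).2, h3.2, h4.2, h1.2, h2.2]
  simp only [smul_eq_mul]
  ring

end EulerSumAux

namespace EulerSumAux

lemma hasSum_Fr {t : ℝ} (ht : 0 < t) :
    HasSum (fun n : ℕ => ((harmonic (n+1) : ℚ) : ℝ) * Real.exp (-((n+1:ℕ):ℝ) * t)) (Fr t) := by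
  set y := Real.exp (-t) with hy
  have hy0 : 0 < y := Real.exp_pos _
  have hy1 : y < 1 := by rw [hy, Real.exp_lt_one_iff]; linarith
  have hf := Real.hasSum_pow_div_log_of_abs_lt_one (x := y) (by rwa [abs_of_pos hy0])
  have hg := hasSum_geometric_of_lt_one hy0.le hy1
  have hfn : Summable fun n : ℕ => ‖y ^ (n + 1) / ((n:ℝ) + 1)‖ := by
    refine hf.summable.congr fun n => ?_
    rw [Real.norm_eq_abs, abs_of_nonneg (by positivity)]
  have hgn : Summable fun n : ℕ => ‖y ^ n‖ := by
    refine hg.summable.congr fun n => ?_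
    rw [Real.norm_eq_abs, abs_of_nonneg (by positivity)]
  have := hasSum_sum_range_mul_of_summable_norm hfn hgn
  rw [hf.tsum_eq, hg.tsum_eq] at this
  rw [Fr, ← hy, div_eq_mul_inv]
  convert! this using 1
  funext n
  have e : Real.exp (-((n+1:ℕ):ℝ) * t) = y ^ (n+1) := by
    rw [hy, ← Real.exp_nat_mul]; congr 1; ring
  rw [e, harmonic]
  push_cast
  rw [Finset.sum_mul]
  refine Finset.sum_congr rfl fun k hk => ?_
  have hk : k ≤ n := by simpa [Nat.lt_succ_iff] using hk
  have : y ^ (n+1) = y ^ (k+1) * y ^ (n-k) := by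
    rw [← pow_add]; congr 1; omega
  rw [this]; ring

lemma harmonic_summable {σ : ℝ} (hσ : 1 < σ) :
    Summable fun n : ℕ => ‖((harmonic (n+1) : ℚ) : ℂ)‖ / (((n+1:ℕ):ℝ)) ^ σ := by
  set ε := (σ - 1) / 2 with hε
  have hε0 : 0 < ε := by rw [hε]; linarith
  have hs : Summable fun n : ℕ => (1 + 1/ε) * (1 / ((n+1:ℕ):ℝ) ^ (σ - ε)) := by
    refine Summable.mul_left _ ?_
    have := Real.summable_one_div_nat_rpow.2 (show 1 < σ - ε by rw [hε]; linarith)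
    exact (summable_nat_add_iff 1).2 this
  refine Summable.of_nonneg_of_le (fun n => by positivity) (fun n => ?_) hs
  have hn : (1:ℝ) ≤ ((n+1:ℕ):ℝ) := by push_cast; linarith [Nat.cast_nonneg (α := ℝ) n]
  have h1 : ‖((harmonic (n+1) : ℚ) : ℂ)‖ ≤ 1 + Real.log ((n+1:ℕ):ℝ) := by
    have e : ‖((harmonic (n+1) : ℚ) : ℂ)‖ = ((harmonic (n+1) : ℚ) : ℝ) := by
      have : ((harmonic (n+1) : ℚ) : ℂ) = (((harmonic (n+1) : ℚ) : ℝ) : ℂ) := by push_cast; rfl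
      rw [this, Complex.norm_real, Real.norm_eq_abs, abs_of_nonneg]
      exact_mod_cast (harmonic_pos (Nat.succ_ne_zero n)).le
    rw [e]
    exact harmonic_le_one_add_log (n+1)
  set x := ((n+1:ℕ):ℝ)
  have hx0 : 0 < x := by linarith
  have h2 : Real.log x ≤ x ^ ε / ε := Real.log_le_rpow_div hx0.le hε0
  have h3 : (1:ℝ) ≤ x ^ ε := Real.one_le_rpow hn hε0.le
  have h4 : x ^ (σ - ε) = x ^ σ / x ^ ε := Real.rpow_sub hx0 _ _
  have h5 : 0 < x ^ σ := Real.rpow_pos_of_pos hx0 _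
  rw [h4, one_div_div (x ^ σ) (x ^ ε), ← mul_div_assoc]
  refine div_le_div_of_nonneg_right ?_ h5.le
  calc _ ≤ 1 + x ^ ε / ε := by linarith
    _ ≤ x ^ ε + x ^ ε / ε := by linarith
    _ = _ := by ring

lemma mellin_F {s : ℂ} (hs : 1 < s.re) : mellin (fN 0) s = Complex.Gamma s *
    ∑' n : ℕ, ((harmonic (n + 1) : ℚ) : ℂ) * ((n + 1 : ℕ) : ℂ) ^ (-s) := by
  have := hasSum_mellin (a := fun n : ℕ => ((harmonic (n + 1) : ℚ) : ℂ)) (p := fun n : ℕ => ((n+1:ℕ):ℝ))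
    (F := fN 0) (s := s) (fun i => Or.inr (by positivity)) (by linarith) (fun t ht => ?_)
    (harmonic_summable hs)
  · rw [← this.tsum_eq, ← tsum_mul_left]
    refine tsum_congr fun n => ?_
    rw [Complex.cpow_neg, mul_div_assoc, div_eq_mul_inv]
    norm_num
  · have h := Complex.hasSum_ofReal.2 (hasSum_Fr (t := t) ht)
    have e : fN 0 t = (Fr t : ℂ) := by simp [fN]
    rw [e]
    convert! h using 1
    funext n
    push_cast; rfl

end EulerSumAux

namespace EulerSumAux

noncomputable def Ek (k : ℕ) (s : ℂ) : ℂ := (Complex.Gamma (s + k + 1))⁻¹ * ∏ i ∈ range k, (s + i)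

lemma Gamma_inv_prod (k : ℕ) (s : ℂ) :
    (Complex.Gamma s)⁻¹ = (Complex.Gamma (s + k))⁻¹ * ∏ i ∈ range k, (s + i) := by
  induction k with
  | zero => simp
  | succ k ih =>
    rw [ih, Finset.prod_range_succ, Complex.one_div_Gamma_eq_self_mul_one_div_Gamma_add_one (s + k)]
    push_cast
    rw [add_assoc]
    ring

lemma Ek_mul (k : ℕ) (s : ℂ) : (s + k) * Ek k s = (Complex.Gamma s)⁻¹ := by
  rw [Gamma_inv_prod k s, Ek, Complex.one_div_Gamma_eq_self_mul_one_div_Gamma_add_one (s + k)]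
  ring

lemma Ek_diff (k : ℕ) : Differentiable ℂ (Ek k) := by
  have h := Complex.differentiable_one_div_Gamma
  have h2 : Differentiable ℂ fun s : ℂ => (Complex.Gamma (s + k + 1))⁻¹ :=
    h.comp (f := fun s : ℂ => s + k + 1) (by fun_prop)
  unfold Ek
  exact h2.mul (by fun_prop)

lemma Ek_eq {K : ℕ} {s : ℂ} (h : Complex.Gamma (1 - s) ≠ 0) :
    Ek K s = (-1) ^ K * Complex.Gamma (1 - s) *
      ((Complex.Gamma (1 - (s + K)))⁻¹ * (Complex.Gamma (1 + (s + K)))⁻¹) := by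
  have h1 := Gamma_inv_prod K (1 - (s + K))
  rw [show (1 - (s + K) + K : ℂ) = 1 - s by ring] at h1
  have h2 : ∏ i ∈ range K, (s + i) = (-1) ^ K * ∏ i ∈ range K, (1 - (s + K) + i) := by
    rw [← Finset.prod_range_reflect]
    have : ((-1:ℂ)) ^ K = ∏ i ∈ range K, (-1 : ℂ) := by simp
    rw [this, ← Finset.prod_mul_distrib]
    refine Finset.prod_congr rfl fun i hi => ?_
    have hi : i < K := by simpa using hi
    have : ((K - 1 - i : ℕ) : ℂ) = K - 1 - i := by
      rw [Nat.sub_sub, Nat.cast_sub (by omega)]; push_cast; ring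
    rw [this]; ring
  rw [h1, Ek, h2, show s + K + 1 = 1 + (s + K) by ring]
  field_simp

lemma w_deriv : HasDerivAt (fun t : ℂ => (Complex.Gamma (1 - t))⁻¹ * (Complex.Gamma (1 + t))⁻¹) 0 0 := by
  set w := (fun t : ℂ => (Complex.Gamma (1 - t))⁻¹ * (Complex.Gamma (1 + t))⁻¹) with hw
  have h := Complex.differentiable_one_div_Gamma
  have hd : Differentiable ℂ w :=
    (h.comp (f := fun t : ℂ => 1 - t) (by fun_prop)).mul (h.comp (f := fun t : ℂ => 1 + t) (by fun_prop))
  have h1 := (hd 0).hasDerivAt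
  have h2 : HasDerivAt (fun t : ℂ => w (-t)) (deriv w 0 * (-1)) 0 := by
    have h1' : HasDerivAt w (deriv w 0) (-0) := by simpa using h1
    exact h1'.comp (0:ℂ) (hasDerivAt_neg (0:ℂ))
  have e : (fun t : ℂ => w (-t)) = w := by
    funext t
    simp only [hw, sub_neg_eq_add, ← sub_eq_add_neg]
    ring
  rw [e] at h2
  have := h1.unique h2
  have h0 : deriv w 0 = 0 := by
    have h3 : (2:ℂ) * deriv w 0 = 0 := by linear_combination this
    simpa using h3
  rwa [h0] at h1

lemma Ek_deriv (K : ℕ) : HasDerivAt (Ek K) (-((-1) ^ K * deriv Complex.Gamma (K + 1))) (-(K:ℂ)) := by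
  have hne : ∀ m : ℕ, (1 - (-(K:ℂ))) ≠ -m := by
    intro m h
    have := congrArg Complex.re h
    simp at this
    have h1 : (0:ℝ) ≤ K := Nat.cast_nonneg _
    have h2 : (0:ℝ) ≤ m := Nat.cast_nonneg _
    linarith
  have hG := (Complex.differentiableAt_Gamma (1 - (-(K:ℂ))) hne).hasDerivAt
  have hGne : Complex.Gamma (1 - (-(K:ℂ))) ≠ 0 := Complex.Gamma_ne_zero hne
  have h1 : HasDerivAt (fun s : ℂ => Complex.Gamma (1 - s)) (deriv Complex.Gamma (1 - (-(K:ℂ))) * (-1)) (-(K:ℂ)) :=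
    hG.comp (-(K:ℂ)) ((hasDerivAt_id _).const_sub 1)
  have h2 : HasDerivAt (fun s : ℂ => (Complex.Gamma (1 - (s + K)))⁻¹ * (Complex.Gamma (1 + (s + K)))⁻¹)
      (0 * 1) (-(K:ℂ)) := by
    have hw := w_deriv
    rw [show (0:ℂ) = -(K:ℂ) + K by ring] at hw
    rw [show (0:ℂ) * 1 = (-(K:ℂ) + K) * 1 by ring]
    exact hw.comp (-(K:ℂ)) ((hasDerivAt_id _).add_const (K:ℂ))
  have h3 := (h1.const_mul ((-1) ^ K)).mul h2
  have ev : ∀ᶠ s in 𝓝 (-(K:ℂ)), Complex.Gamma (1 - s) ≠ 0 := h1.continuousAt.eventually_ne hGne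
  refine (h3.congr_of_eventuallyEq (ev.mono fun s hs => Ek_eq hs)).congr_deriv ?_
  simp
  rw [show (1 + (K:ℂ)) = K + 1 by ring]

lemma Ek_self (K : ℕ) : Ek K (-(K:ℂ)) = (-1) ^ K * (K.factorial : ℂ) := by
  have e : (1 - (-(K:ℂ))) = (K:ℂ) + 1 := by ring
  rw [Ek_eq (by rw [e, Complex.Gamma_nat_eq_factorial]; exact_mod_cast K.factorial_ne_zero), e,
    Complex.Gamma_nat_eq_factorial]
  simp

lemma Gamma_inv_neg (K : ℕ) : (Complex.Gamma (-(K:ℂ)))⁻¹ = 0 := by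
  rw [Complex.Gamma_neg_nat_eq_zero, inv_zero]

lemma Ek_ne {n K : ℕ} (h : n < K) : Ek n (-(K:ℂ)) = 0 := by
  have := Ek_mul n (-(K:ℂ))
  rw [Gamma_inv_neg] at this
  refine (mul_eq_zero.1 this).resolve_left ?_
  intro h0
  have : (n:ℂ) = K := by linear_combination h0
  have := Nat.cast_injective this
  omega

noncomputable def HN (N : ℕ) (s : ℂ) : ℂ :=
  (Complex.Gamma s)⁻¹ * mellin (fN (N+1)) s + (Complex.Gamma s)⁻¹ / (s - 1) ^ 2
    + ∑ n ∈ range N, ((bR (n+1) : ℂ) * (Ek n s / (s + n)) - aR (n+1) * Ek n s)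

lemma bR_eq (n : ℕ) : bR n = ((bernoulli' n : ℚ) : ℝ) / n.factorial := by
  simp [bR, bernoulli'PowerSeries]

lemma HN_succ {N : ℕ} {s : ℂ} (hs : -(N:ℝ) < s.re) : HN N s = HN (N+1) s := by
  have hs' : 1 - ((N+1:ℕ):ℝ) < s.re := by push_cast; linarith
  have h := fN_succ (N+1) hs'
  have hne := re_pos_ne hs'
  rw [show s + ((N+1:ℕ):ℂ) - 1 = s + N by push_cast; ring] at h hne
  rw [HN, HN, Finset.sum_range_succ, h, ← Ek_mul N s]
  field_simp
  ring

lemma HN_le {N M : ℕ} (hNM : N ≤ M) {s : ℂ} (hs : -(N:ℝ) < s.re) : HN N s = HN M s := by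
  induction M, hNM using Nat.le_induction with
  | base => rfl
  | succ M hM ih =>
    rw [ih]
    refine HN_succ ?_
    have : (N:ℝ) ≤ M := by exact_mod_cast hM
    linarith

noncomputable def Hf (s : ℂ) : ℂ := HN (⌈|s.re|⌉₊ + 1) s

lemma Hf_eq {N : ℕ} {s : ℂ} (hs : -(N:ℝ) < s.re) : Hf s = HN N s := by
  have h1 : -((⌈|s.re|⌉₊ + 1 : ℕ):ℝ) < s.re := by
    have := Nat.le_ceil |s.re|
    have h2 := neg_abs_le s.re
    push_cast; linarith
  rw [Hf]
  rcases le_total N (⌈|s.re|⌉₊ + 1) with h | h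
  · exact (HN_le h hs).symm
  · exact HN_le h h1

lemma Hf_ev {N : ℕ} {s : ℂ} (hs : -(N:ℝ) < s.re) : Hf =ᶠ[𝓝 s] HN N := by
  have : ∀ᶠ z : ℂ in 𝓝 s, -(N:ℝ) < z.re :=
    (isOpen_lt continuous_const Complex.continuous_re).mem_nhds hs
  filter_upwards [this] with z hz using Hf_eq hz

lemma Hf_tsum {s : ℂ} (hs : 1 < s.re) :
    Hf s = ∑' n : ℕ, ((harmonic (n + 1) : ℚ) : ℂ) * ((n + 1 : ℕ) : ℂ) ^ (-s) := by
  rw [Hf_eq (N := 0) (by simp; linarith), HN]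
  have h := fN_succ 0 (s := s) (by simpa using hs)
  rw [mellin_F hs] at h
  have hG : Complex.Gamma s ≠ 0 := Complex.Gamma_ne_zero_of_re_pos (by linarith)
  have hb : bR 0 = 1 := by simp [bR_eq]
  have ha : aR 0 = 0 := by simp [aR, lSer, PowerSeries.coeff_mul]
  rw [hb, ha] at h
  simp only [Nat.cast_zero, add_zero, zero_add, Complex.ofReal_one, Complex.ofReal_zero, zero_mul, sub_zero, one_mul] at h
  simp only [Finset.range_zero, Finset.sum_empty, add_zero, zero_add]
  rw [div_eq_mul_one_div _ ((s-1)^2), ← mul_add, ← h, inv_mul_cancel_left₀ hG]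

lemma mellin_an (N : ℕ) {s : ℂ} (hs : 1 - (N:ℝ) < s.re) : AnalyticAt ℂ (mellin (fN N)) s := by
  have ho : IsOpen {z : ℂ | 1 - (N:ℝ) < z.re} := isOpen_lt continuous_const Complex.continuous_re
  have : DifferentiableOn ℂ (mellin (fN N)) {z : ℂ | 1 - (N:ℝ) < z.re} :=
    fun z hz => (fN_diff N hz).differentiableWithinAt
  exact this.analyticAt (ho.mem_nhds hs)

lemma HN_an {N : ℕ} {s : ℂ} (hs : -(N:ℝ) < s.re) (hU : s ∈ eulerSumDomain) : AnalyticAt ℂ (HN N) s := by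
  obtain ⟨h1, h0, hm⟩ := hU
  have hG : AnalyticAt ℂ (fun s => (Complex.Gamma s)⁻¹) s := Complex.differentiable_one_div_Gamma.analyticAt s
  have hid : AnalyticAt ℂ (fun s : ℂ => s) s := analyticAt_id
  refine ((hG.mul (mellin_an (N+1) (by push_cast; linarith))).add ?_).add ?_
  · exact hG.div ((hid.sub analyticAt_const).pow 2) (pow_ne_zero 2 (sub_ne_zero.2 h1))
  · refine Finset.analyticAt_fun_sum _ fun n _ => ?_
    have hE : AnalyticAt ℂ (Ek n) s := (Ek_diff n).analyticAt s
    refine AnalyticAt.sub ?_ (analyticAt_const.mul hE)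
    by_cases hn : s + n = 0
    · have hs' : s = -(n:ℂ) := by linear_combination hn
      have hb : bR (n+1) = 0 := by
        rw [bR_eq, bernoulli'_eq_zero_of_odd]
        · simp
        · rcases Nat.even_or_odd n with he | ⟨k, hk⟩
          · exact he.add_one
          · exfalso
            refine hm (k+1) (by omega) ?_
            rw [hs', hk]; push_cast; ring
        · have : n ≠ 0 := by
            rintro rfl
            exact h0 (by simpa using hs')
          omega
      simp only [hb, Complex.ofReal_zero, zero_mul]
      exact analyticAt_const
    · exact analyticAt_const.mul (hE.div (hid.add analyticAt_const) hn)

lemma Hf_an : AnalyticOnNhd ℂ Hf eulerSumDomain := by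
  intro s hU
  obtain ⟨N, hN⟩ := exists_nat_gt (-s.re)
  have hs : -(N:ℝ) < s.re := by linarith
  exact (HN_an hs hU).congr (Hf_ev hs).symm

lemma aR_eq {m : ℕ} (hm : 2 ≤ m) : (aR (2*m) : ℂ) = convA (2*m) := by
  rw [aR, PowerSeries.coeff_mul, Finset.Nat.sum_antidiagonal_eq_sum_range_succ_mk, convA,
    Finset.range_eq_Ico, Finset.sum_eq_sum_Ico_succ_bot (by omega)]
  have e : Finset.Ico (0+1) (2*m).succ = Finset.Icc 1 (2*m) := by
    ext i; simp only [Finset.mem_Ico, Finset.mem_Icc]; omega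
  rw [e]
  simp only [lSer, bernoulli'PowerSeries, PowerSeries.coeff_mk]
  push_cast
  simp only [mul_zero, div_zero, zero_mul, zero_add]
  refine Finset.sum_congr rfl fun k hk => ?_
  by_cases h1 : k = 1
  · have : bernoulli' (2*m - k) = 0 := bernoulli'_eq_zero_of_odd ⟨m-1, by omega⟩ (by omega)
    rw [this]; simp
  · rw [bernoulli_eq_bernoulli'_of_ne_one h1]
    simp

lemma Hf_lim {K : ℕ} (hK : 1 ≤ K) :
    Tendsto (fun s : ℂ => Hf s - bR (K+1) * Ek K (-(K:ℂ)) / (s + K)) (𝓝[≠] (-(K:ℂ)))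
      (𝓝 (bR (K+1) * (-((-1) ^ K * deriv Complex.Gamma (K + 1))) - aR (K+1) * Ek K (-(K:ℂ)))) := by
  have hs : -((K+1:ℕ):ℝ) < (-(K:ℂ)).re := by simp
  have hslope := (hasDerivAt_iff_tendsto_slope.1 (Ek_deriv K)).const_mul (bR (K+1) : ℂ)
  have hG : ContinuousAt (fun s => (Complex.Gamma s)⁻¹) (-(K:ℂ)) :=
    Complex.differentiable_one_div_Gamma.continuous.continuousAt
  have hK0 : (0:ℝ) ≤ K := Nat.cast_nonneg _
  have hne1 : (-(K:ℂ)) - 1 ≠ 0 := by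
    intro h
    have := congrArg Complex.re h
    simp at this
    linarith
  have hrest : ContinuousAt (fun s => (Complex.Gamma s)⁻¹ * mellin (fN (K+1+1)) s + (Complex.Gamma s)⁻¹ / (s - 1) ^ 2
    + ∑ n ∈ range K, ((bR (n+1) : ℂ) * (Ek n s / (s + n)) - aR (n+1) * Ek n s) - aR (K+1) * Ek K s) (-(K:ℂ)) := by
    have c1 : ContinuousAt (fun s => (Complex.Gamma s)⁻¹ * mellin (fN (K+1+1)) s) (-(K:ℂ)) :=
      hG.mul (fN_diff (K+1+1) (by push_cast; simp)).continuousAt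
    have c2 : ContinuousAt (fun s => (Complex.Gamma s)⁻¹ / (s - 1) ^ 2) (-(K:ℂ)) := by
      have c : ContinuousAt (fun s : ℂ => (s - 1) ^ 2) (-(K:ℂ)) := by fun_prop
      exact hG.div c (pow_ne_zero 2 hne1)
    have c4 : ContinuousAt (fun s => (aR (K+1) : ℂ) * Ek K s) (-(K:ℂ)) :=
      continuousAt_const.mul (Ek_diff K).continuous.continuousAt
    refine ((c1.add c2).add ?_).sub c4
    refine tendsto_finsetSum _ fun n hn => ?_
    have hn : n < K := by simpa using hn
    have hE : ContinuousAt (Ek n) (-(K:ℂ)) := (Ek_diff n).continuous.continuousAt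
    refine ContinuousAt.sub (continuousAt_const.mul (hE.div (continuousAt_id.add continuousAt_const) ?_)) (continuousAt_const.mul hE)
    intro h0
    have : (n:ℂ) = K := by linear_combination h0
    have := Nat.cast_injective this
    omega
  have hr := hrest.tendsto.mono_left (nhdsWithin_le_nhds (s := {(-(K:ℂ))}ᶜ))
  have hz : ∑ n ∈ range K, ((bR (n+1) : ℂ) * (Ek n (-(K:ℂ)) / (-(K:ℂ) + n)) - aR (n+1) * Ek n (-(K:ℂ))) = 0 := by
    refine Finset.sum_eq_zero fun n hn => ?_
    rw [Ek_ne (by simpa using hn)]; simp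
  simp only [hz, Gamma_inv_neg] at hr
  have := hslope.add hr
  convert! this.congr' ?_ using 2
  · simp; ring
  · filter_upwards [self_mem_nhdsWithin, (Hf_ev hs).filter_mono nhdsWithin_le_nhds] with s hs1 hs2
    have hne : s + K ≠ 0 := by
      intro h; exact hs1 (by simp; linear_combination h)
    rw [hs2, HN, Finset.sum_range_succ, slope_def_field, sub_neg_eq_add]
    field_simp
    ring

end EulerSumAux

/-- There is an analytic continuation `H` of the Euler sum `h(s) = Σ_{n=1}^∞ H_n n^{−s}`
to `U = ℂ \ ({1, 0} ∪ {1 − 2m : m ≥ 1})`, such that for every integer `m ≥ 2`,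
`H(s) − ζ(1 − 2m)/(s + 2m − 1) → (2m − 1)!·A_{2m} − ψ(2m)·ζ(1 − 2m)` as `s → 1 − 2m`
within `U`, where `ψ(s) = Γ′(s)/Γ(s)`. -/
theorem eulerSum_expansion_at_neg_odd :
    ∃ H : ℂ → ℂ, AnalyticOnNhd ℂ H eulerSumDomain ∧
      (∀ s : ℂ, 1 < s.re →
        H s = ∑' n : ℕ, ((harmonic (n + 1) : ℚ) : ℂ) * ((n + 1 : ℕ) : ℂ) ^ (-s)) ∧
      (∀ m : ℕ, 2 ≤ m →
        Tendsto (fun s : ℂ => H s - riemannZeta (1 - 2 * m) / (s + 2 * m - 1))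
          (𝓝[eulerSumDomain] (1 - 2 * (m : ℂ)))
          (𝓝 ((Nat.factorial (2 * m - 1) : ℂ) * convA (2 * m)
            - (deriv Complex.Gamma (2 * m) / Complex.Gamma (2 * m)) *
                riemannZeta (1 - 2 * m)))) := by
  refine ⟨EulerSumAux.Hf, EulerSumAux.Hf_an, fun s hs => EulerSumAux.Hf_tsum hs, fun m hm => ?_⟩
  obtain ⟨K, hK⟩ : ∃ K, K + 1 = 2 * m := ⟨2 * m - 1, by omega⟩
  have hKc : (K:ℂ) + 1 = 2 * m := by exact_mod_cast hK
  have hodd : Odd K := ⟨m - 1, by omega⟩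
  have h := EulerSumAux.Hf_lim (K := K) (by omega)
  have e0 : (1 - 2 * (m:ℂ)) = -(K:ℂ) := by rw [← hKc]; ring
  have hsub : eulerSumDomain ⊆ {(-(K:ℂ))}ᶜ := by
    intro s hs hsK
    refine hs.2.2 m (by omega) ?_
    rw [e0]; exact hsK
  have hf : (2 * m - 1).factorial = K.factorial := by congr 1; omega
  have hfK : (K.factorial : ℂ) ≠ 0 := by exact_mod_cast K.factorial_ne_zero
  have hK1 : (K:ℂ) + 1 ≠ 0 := by exact_mod_cast K.succ_ne_zero
  have hz : riemannZeta (-(K:ℂ)) = EulerSumAux.bR (K+1) * EulerSumAux.Ek K (-(K:ℂ)) := by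
    rw [riemannZeta_neg_nat_eq_bernoulli', EulerSumAux.Ek_self, hodd.neg_one_pow, EulerSumAux.bR_eq,
      Nat.factorial_succ]
    push_cast
    field_simp
  have h2 := h.mono_left (nhdsWithin_mono _ hsub)
  rw [e0]
  convert! h2 using 2
  · rw [hz, ← hKc]; congr 2; ring
  · rw [hf, ← EulerSumAux.aR_eq hm, ← hK, ← hKc, Complex.Gamma_nat_eq_factorial, hz, EulerSumAux.Ek_self,
      hodd.neg_one_pow]
    field_simp
    ring
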